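/- The index set EXL = {e : e codes a u.c.e. family that is TxtEx-learnable by some learner} is a Σ⁰₄ set, i.e., membership in EXL is definable by a Σ⁰₄ predicate. -/

import Mathlib

/-- `Wset e` is the `e`-th computably enumerable set: the domain of the `e`-th
partial computable function in the standard numbering by codes. -/
def Wset (e : ℕ) : Set ℕ :=
  {x | ((Denumerable.ofNat Nat.Partrec.Code e).eval x).Dom}

/-- The `i`-th column `{x : ⟨i,x⟩ ∈ W_a}` of the c.e. set coded by `a`;
the number `a` codes the u.c.e. family whose members are its columns. -/
def column (a i : ℕ) : Set ℕ := {x | Nat.pair i x ∈ Wset a}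

/-- The initial segment of length `n` of an enumeration `f`. -/
def initSeg (f : ℕ → ℕ) (n : ℕ) : List ℕ := (List.range n).map f

/-- The `m`-th computable learner in the standard effective enumeration of all
partial computable functions from finite sequences to ℕ. -/
def learnerOfCode (m : ℕ) : List ℕ →. ℕ :=
  fun σ => (Denumerable.ofNat Nat.Partrec.Code m).eval (Encodable.encode σ)

/-- `M` TxtFin-identifies the enumeration `f` (here `Option.none` plays the
role of the symbol `?`). -/
def TxtFinIdentifies (M : List ℕ →. Option ℕ) (f : ℕ → ℕ) : Prop :=
  ∃ n h, (∀ n' < n, M (initSeg f n') = Part.some Option.none) ∧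
    M (initSeg f n) = Part.some (Option.some h) ∧ Wset h = Set.range f

/-- `M` TxtFin-learns the set `S`. -/
def TxtFinLearnsSet (M : List ℕ →. Option ℕ) (S : Set ℕ) : Prop :=
  ∀ f : ℕ → ℕ, Set.range f = S → TxtFinIdentifies M f

/-- `M` TxtEx-identifies the enumeration `f`. -/
def TxtExIdentifies (M : List ℕ →. ℕ) (f : ℕ → ℕ) : Prop :=
  ∃ n, (∃ N, ∀ i ≥ N, M (initSeg f i) = Part.some n) ∧ Wset n = Set.range f

/-- `M` TxtEx-learns the set `S`. -/
def TxtExLearnsSet (M : List ℕ →. ℕ) (S : Set ℕ) : Prop :=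
  ∀ f : ℕ → ℕ, Set.range f = S → TxtExIdentifies M f

/-- `M` TxtBC-identifies the enumeration `f`. -/
def TxtBCIdentifies (M : List ℕ →. ℕ) (f : ℕ → ℕ) : Prop :=
  ∃ N, ∀ i ≥ N, ∃ h, M (initSeg f i) = Part.some h ∧ Wset h = Set.range f

/-- `M` TxtBC-learns the set `S`. -/
def TxtBCLearnsSet (M : List ℕ →. ℕ) (S : Set ℕ) : Prop :=
  ∀ f : ℕ → ℕ, Set.range f = S → TxtBCIdentifies M f

/-- `M` TxtEx*-identifies the enumeration `f`. -/
def TxtExStarIdentifies (M : List ℕ →. ℕ) (f : ℕ → ℕ) : Prop :=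
  ∃ n, (∃ N, ∀ i ≥ N, M (initSeg f i) = Part.some n) ∧
    (symmDiff (Wset n) (Set.range f)).Finite

/-- `M` TxtEx*-learns the set `S`. -/
def TxtExStarLearnsSet (M : List ℕ →. ℕ) (S : Set ℕ) : Prop :=
  ∀ f : ℕ → ℕ, Set.range f = S → TxtExStarIdentifies M f

/-- Indices of cofinite c.e. sets. -/
def COF : Set ℕ := {e | (Wset e)ᶜ.Finite}

/-- Indices of coinfinite c.e. sets. -/
def COINF : Set ℕ := {e | (Wset e)ᶜ.Infinite}

/-- `P` is Σ⁰₃: definable by `∃∀∃` over a computable relation. -/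
def IsSigma3 (P : Set ℕ) : Prop :=
  ∃ R : ℕ → ℕ → ℕ → ℕ → Bool,
    Computable (fun p : ℕ × ℕ × ℕ × ℕ => R p.1 p.2.1 p.2.2.1 p.2.2.2) ∧
    ∀ e, e ∈ P ↔ ∃ x, ∀ y, ∃ z, R e x y z = true

/-- `P` is Σ⁰₄: definable by `∃∀∃∀` over a computable relation. -/
def IsSigma4 (P : Set ℕ) : Prop :=
  ∃ R : ℕ → ℕ → ℕ → ℕ → ℕ → Bool,
    Computable (fun p : ℕ × ℕ × ℕ × ℕ × ℕ =>
      R p.1 p.2.1 p.2.2.1 p.2.2.2.1 p.2.2.2.2) ∧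
    ∀ e, e ∈ P ↔ ∃ x, ∀ y, ∃ z, ∀ w, R e x y z w = true

/-- `P` is Σ⁰₅: definable by `∃∀∃∀∃` over a computable relation. -/
def IsSigma5 (P : Set ℕ) : Prop :=
  ∃ R : ℕ → ℕ → ℕ → ℕ → ℕ → ℕ → Bool,
    Computable (fun p : ℕ × ℕ × ℕ × ℕ × ℕ × ℕ =>
      R p.1 p.2.1 p.2.2.1 p.2.2.2.1 p.2.2.2.2.1 p.2.2.2.2.2) ∧
    ∀ e, e ∈ P ↔ ∃ x, ∀ y, ∃ z, ∀ w, ∃ v, R e x y z w v = true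

/-- `f : ℕ → ℕ` is Δ⁰₂: the pointwise limit of a computable function. -/
def IsDelta2Fun (f : ℕ → ℕ) : Prop :=
  ∃ g : ℕ → ℕ → ℕ, Computable₂ g ∧ ∀ x, ∃ s₀, ∀ s ≥ s₀, g s x = f x

/-- The index set of codes of TxtEx-learnable u.c.e. families. -/
def EXL : Set ℕ :=
  {e | ∃ M : List ℕ →. ℕ, Partrec M ∧ ∀ i, TxtExLearnsSet M (column e i)}

open Filter
open Nat.Partrec (Code)
open Denumerable (ofNat)
open Encodable (encode)

/-- The pair `(σ, n)` is a weak stabilizing pair for the learner `M` on `S`: no extension of `σ` by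
elements of `S` is ever mapped by `M` to a hypothesis other than `n`. -/
def StableOn (M : List ℕ →. ℕ) (S : Set ℕ) (σ : List ℕ) (n : ℕ) : Prop :=
  ∀ ρ : List ℕ, (∀ x ∈ ρ, x ∈ S) → ∀ v ∈ M (σ ++ ρ), v = n

theorem initSeg_length (f : ℕ → ℕ) (n : ℕ) : (initSeg f n).length = n := by simp [initSeg]

theorem mem_initSeg {f : ℕ → ℕ} {n x : ℕ} : x ∈ initSeg f n ↔ ∃ j < n, f j = x := by
  simp [initSeg]

theorem eventually_subset_initSeg {f : ℕ → ℕ} {σ : List ℕ} (h : ∀ x ∈ σ, x ∈ Set.range f) :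
    ∀ᶠ s in atTop, ∀ x ∈ σ, x ∈ initSeg f s := by
  induction σ with
  | nil => simp
  | cons a l ih =>
    obtain ⟨j, hj⟩ := h a (by simp)
    filter_upwards [ih fun x hx => h x (by simp [hx]), eventually_gt_atTop j] with s hs hjs
    intro x hx
    rcases List.mem_cons.1 hx with rfl | hx
    · exact mem_initSeg.2 ⟨j, hjs, hj⟩
    · exact hs x hx

/-- A strictly increasing chain of finite sequences has a common infinite extension. -/
theorem exists_forall_initSeg_eq {σ : ℕ → List ℕ} (h : ∀ k, σ k <+: σ (k + 1))
    (hlen : ∀ k, k ≤ (σ k).length) : ∃ f : ℕ → ℕ, ∀ k, initSeg f (σ k).length = σ k := by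
  have hmono : ∀ {j k}, j ≤ k → σ j <+: σ k := fun {j k} hjk => by
    induction hjk with
    | refl => exact List.prefix_rfl
    | step _ ih => exact ih.trans (h _)
  refine ⟨fun j => (σ (j + 1))[j]'(hlen (j + 1)), fun k => ?_⟩
  refine List.ext_getElem (by simp [initSeg]) fun j h₁ h₂ => ?_
  simp only [initSeg, List.getElem_map, List.getElem_range]
  rcases le_total (j + 1) k with hjk | hjk
  · exact (hmono hjk).getElem _
  · exact ((hmono hjk).getElem h₂).symm

/-- The Blum–Blum lemma in weak form: a learner of a nonempty set has a stabilizing pair on it. -/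
theorem TxtExLearnsSet.exists_stableOn {M : List ℕ →. ℕ} {S : Set ℕ} (hM : TxtExLearnsSet M S)
    (hS : S.Nonempty) : ∃ σ n, (∀ x ∈ σ, x ∈ S) ∧ StableOn M S σ n := by
  by_contra! hcon
  have hext : ∀ (σ : {σ : List ℕ // ∀ x ∈ σ, x ∈ S}) (n : ℕ), ∃ ρ : List ℕ,
      (∀ x ∈ ρ, x ∈ S) ∧ ∃ v ∈ M (σ.1 ++ ρ), v ≠ n := by
    intro σ n
    have := hcon σ.1 n σ.2
    unfold StableOn at this
    push Not at this
    exact this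
  choose ext hextS hext using hext
  obtain ⟨g, hg⟩ := S.to_countable.exists_eq_range hS
  have hgS : ∀ k, g k ∈ S := fun k => hg ▸ Set.mem_range_self k
  have hsnoc : ∀ (σ : {σ : List ℕ // ∀ x ∈ σ, x ∈ S}) (k : ℕ), ∀ x ∈ σ.1 ++ [g k], x ∈ S := by
    intro σ k x hx
    rcases List.mem_append.1 hx with hx | hx
    · exact σ.2 x hx
    · rw [List.mem_singleton.1 hx]; exact hgS k
  let step (k : ℕ) (σ : {σ : List ℕ // ∀ x ∈ σ, x ∈ S}) : {σ : List ℕ // ∀ x ∈ σ, x ∈ S} :=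
    ⟨(σ.1 ++ [g k]) ++ ext ⟨_, hsnoc σ k⟩ k.unpair.2, fun x hx =>
      (List.mem_append.1 hx).elim (hsnoc σ k x) (hextS _ _ x)⟩
  let chain (k : ℕ) : {σ : List ℕ // ∀ x ∈ σ, x ∈ S} := Nat.rec ⟨[], by simp⟩ step k
  have hsucc : ∀ k, (chain (k + 1)).1 =
      ((chain k).1 ++ [g k]) ++ ext ⟨_, hsnoc (chain k) k⟩ k.unpair.2 := fun _ => rfl
  have hlen : ∀ k, k ≤ (chain k).1.length := by
    intro k
    induction k with
    | zero => simp
    | succ k ih => rw [hsucc]; simp; omega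
  obtain ⟨f, hf⟩ := exists_forall_initSeg_eq (σ := fun k => (chain k).1)
    (fun k => by rw [hsucc, List.append_assoc]; exact List.prefix_append _ _) hlen
  have hrange : Set.range f = S := by
    ext x
    constructor
    · rintro ⟨j, rfl⟩
      refine (chain (j + 1)).2 _ ?_
      rw [← hf (j + 1)]
      exact mem_initSeg.2 ⟨j, hlen (j + 1), rfl⟩
    · intro hx
      rw [hg] at hx
      obtain ⟨k, rfl⟩ := hx
      have : g k ∈ (chain (k + 1)).1 := by rw [hsucc]; simp
      rw [← hf (k + 1)] at this
      obtain ⟨j, -, hj⟩ := mem_initSeg.1 this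
      exact ⟨j, hj⟩
  obtain ⟨n, ⟨N, hN⟩, -⟩ := hM f hrange
  obtain ⟨v, hv, hvn⟩ := hext ⟨_, hsnoc (chain (Nat.pair N n)) (Nat.pair N n)⟩ n
  have hconv := hN (chain (Nat.pair N n + 1)).1.length
    (by have := hlen (Nat.pair N n + 1); have := Nat.left_le_pair N n; omega)
  rw [hf (Nat.pair N n + 1), hsucc, Nat.unpair_pair] at hconv
  rw [hconv] at hv
  exact hvn (Part.mem_some_iff.1 hv)

/-- Stabilizing pairs of a learner of `S` carry correct hypotheses. -/
theorem TxtExLearnsSet.Wset_eq_of_stableOn {M : List ℕ →. ℕ} {S : Set ℕ}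
    (hM : TxtExLearnsSet M S) (hS : S.Nonempty) {σ : List ℕ} {n : ℕ} (hσ : ∀ x ∈ σ, x ∈ S)
    (hst : StableOn M S σ n) : Wset n = S := by
  obtain ⟨g, rfl⟩ := S.to_countable.exists_eq_range hS
  let f : ℕ → ℕ := fun j => if h : j < σ.length then σ[j] else g (j - σ.length)
  have hrange : Set.range f = Set.range g := by
    ext x
    constructor
    · rintro ⟨j, rfl⟩
      by_cases h : j < σ.length
      · simp only [f, h, dif_pos]
        exact hσ _ (List.getElem_mem h)
      · simp only [f, h, dif_neg, not_false_iff]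
        exact ⟨_, rfl⟩
    · rintro ⟨j, rfl⟩
      exact ⟨σ.length + j, by simp [f]⟩
  obtain ⟨n', ⟨N, hN⟩, hW⟩ := hM f hrange
  have hseg : initSeg f (σ.length + N) = σ ++ initSeg g N := by
    refine List.ext_getElem (by simp [initSeg]) fun j h₁ h₂ => ?_
    by_cases h : j < σ.length
    · simp [initSeg, f, h]
    · simp [initSeg, f, h, List.getElem_append]
  have hconv := hN (σ.length + N) (by omega)
  rw [hseg] at hconv
  have : n' = n := hst (initSeg g N) (fun x hx => by
    obtain ⟨j, -, hj⟩ := mem_initSeg.1 hx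
    exact ⟨j, hj⟩) n' (by rw [hconv]; exact Part.mem_some _)
  rw [← this, hW, hrange]

/-- Within `t` steps, the code `c` maps `σ ++ ρ` to a hypothesis other than `n`. -/
def Changes (c : Code) (σ : List ℕ) (n : ℕ) (ρ : List ℕ) (t : ℕ) : Prop :=
  c.evaln t (encode (σ ++ ρ)) ≠ none ∧ c.evaln t (encode (σ ++ ρ)) ≠ some n

theorem Changes.mono {c : Code} {σ : List ℕ} {n : ℕ} {ρ : List ℕ} {s t : ℕ}
    (h : Changes c σ n ρ s) (hst : s ≤ t) : Changes c σ n ρ t := by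
  obtain ⟨h₁, h₂⟩ := h
  obtain ⟨v, hv⟩ := Option.ne_none_iff_exists'.1 h₁
  have ht : c.evaln t (encode (σ ++ ρ)) = some v := Code.evaln_mono hst hv
  rw [hv] at h₂
  exact ⟨by simp [ht], by rwa [ht]⟩

theorem stableOn_learnerOfCode_iff {m : ℕ} {S : Set ℕ} {σ : List ℕ} {n : ℕ} :
    StableOn (learnerOfCode m) S σ n ↔
      ∀ ρ : List ℕ, (∀ x ∈ ρ, x ∈ S) → ∀ t, ¬ Changes (ofNat Code m) σ n ρ t := by
  refine forall₂_congr fun ρ _ => ⟨fun h t ⟨h₁, h₂⟩ => ?_, fun h v hv => ?_⟩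
  · obtain ⟨v, hv⟩ := Option.ne_none_iff_exists'.1 h₁
    rw [hv] at h₂
    exact h₂ (congrArg some (h v (Code.evaln_sound hv)))
  · obtain ⟨t, ht⟩ := Code.evaln_complete.1 hv
    have ht' : (ofNat Code m).evaln t (encode (σ ++ ρ)) = some v := ht
    by_contra hne
    exact h t ⟨by simp [ht'], by simpa [ht'] using hne⟩

/-- The `k`-th pair looks stabilizing for the code `c`, as far as the data `τ` can tell. -/
def Candidate (c : Code) (τ : List ℕ) (k : ℕ) : Prop :=
  (∀ x ∈ (ofNat (List ℕ × ℕ) k).1, x ∈ τ) ∧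
    ∀ r < τ.length, ¬ ((∀ x ∈ ofNat (List ℕ) r, x ∈ τ) ∧
      Changes c (ofNat (List ℕ × ℕ) k).1 (ofNat (List ℕ × ℕ) k).2 (ofNat (List ℕ) r) τ.length)

open Classical in
/-- The learner that outputs the hypothesis of the first pair that looks stabilizing for `c`. -/
noncomputable def stabilizingLearner (c : Code) (τ : List ℕ) : ℕ :=
  (ofNat (List ℕ × ℕ) ((List.range τ.length).findIdx fun k => decide (Candidate c τ k))).2

theorem findIdx_range_eq {p : ℕ → Bool} {k s : ℕ} (hk : p k = true) (hlt : ∀ j < k, p j = false)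
    (hks : k < s) : (List.range s).findIdx p = k := by
  rw [List.findIdx_eq (by simpa using hks)]
  simpa using ⟨hk, hlt⟩

theorem exists_eventually_stabilizingLearner_eq {m : ℕ} {f : ℕ → ℕ}
    (h : ∃ σ n, (∀ x ∈ σ, x ∈ Set.range f) ∧ StableOn (learnerOfCode m) (Set.range f) σ n) :
    ∃ σ n, (∀ x ∈ σ, x ∈ Set.range f) ∧ StableOn (learnerOfCode m) (Set.range f) σ n ∧
      ∀ᶠ s in atTop, stabilizingLearner (ofNat Code m) (initSeg f s) = n := by
  classical
  let Good (k : ℕ) : Prop := (∀ x ∈ (ofNat (List ℕ × ℕ) k).1, x ∈ Set.range f) ∧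
    StableOn (learnerOfCode m) (Set.range f) (ofNat (List ℕ × ℕ) k).1 (ofNat (List ℕ × ℕ) k).2
  have hex : ∃ k, Good k := by
    obtain ⟨σ, n, h⟩ := h
    exact ⟨encode (σ, n), by simpa only [Good, Denumerable.ofNat_encode] using h⟩
  have hgood := Nat.find_spec hex
  have hmin : ∀ j < Nat.find hex, ¬ Good j := fun j => Nat.find_min hex
  generalize Nat.find hex = k at hgood hmin
  refine ⟨_, _, hgood.1, hgood.2, ?_⟩
  have hk : ∀ᶠ s in atTop, Candidate (ofNat Code m) (initSeg f s) k := by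
    filter_upwards [eventually_subset_initSeg hgood.1] with s hs
    refine ⟨hs, fun r _ ⟨hr, hch⟩ => ?_⟩
    refine stableOn_learnerOfCode_iff.1 hgood.2 _ (fun x hx => ?_) _ hch
    obtain ⟨j, -, hj⟩ := mem_initSeg.1 (hr x hx)
    exact ⟨j, hj⟩
  have hlt : ∀ᶠ s in atTop, ∀ j ∈ Set.Iio k, ¬ Candidate (ofNat Code m) (initSeg f s) j := by
    refine (eventually_all_finite (Set.finite_Iio k)).2 fun j hj => ?_
    by_cases hsub : ∀ x ∈ (ofNat (List ℕ × ℕ) j).1, x ∈ Set.range f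
    · have hns : ¬ StableOn _ _ _ _ := fun hst => hmin j hj ⟨hsub, hst⟩
      rw [stableOn_learnerOfCode_iff] at hns
      push Not at hns
      obtain ⟨ρ, hρ, t, hch⟩ := hns
      filter_upwards [eventually_subset_initSeg hρ, eventually_gt_atTop (encode ρ),
        eventually_ge_atTop t] with s hs hrs hts hc
      refine hc.2 (encode ρ) (by rwa [initSeg_length]) ⟨?_, ?_⟩
      · simpa only [Denumerable.ofNat_encode] using hs
      · rw [initSeg_length, Denumerable.ofNat_encode]
        exact hch.mono hts
    · push Not at hsub
      obtain ⟨x, hx, hxf⟩ := hsub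
      refine Eventually.of_forall fun s hc => hxf ?_
      obtain ⟨i, -, hi⟩ := mem_initSeg.1 (hc.1 x hx)
      exact ⟨i, hi⟩
  filter_upwards [hk, hlt, eventually_gt_atTop k] with s h₁ h₂ h₃
  rw [stabilizingLearner, initSeg_length,
    findIdx_range_eq (decide_eq_true h₁) (fun j hj => decide_eq_false (h₂ j hj)) h₃]

theorem primrec_evaln_comp {α : Type*} [Primcodable α] {t x : α → ℕ} {c : α → Code}
    (ht : Primrec t) (hc : Primrec c) (hx : Primrec x) :
    Primrec fun a => (c a).evaln (t a) (x a) :=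
  Code.primrec_evaln.comp ((ht.pair hc).pair hx)

theorem PrimrecPred.changes {α : Type*} [Primcodable α] {c : α → Code} {σ ρ : α → List ℕ}
    {n t : α → ℕ} (hc : Primrec c) (hσ : Primrec σ) (hn : Primrec n) (hρ : Primrec ρ)
    (ht : Primrec t) : PrimrecPred fun a => Changes (c a) (σ a) (n a) (ρ a) (t a) := by
  have he := primrec_evaln_comp ht hc (Primrec.encode.comp (Primrec.list_append.comp hσ hρ))
  exact (Primrec.eq.comp he (Primrec.const none)).not.and
    (Primrec.eq.comp he (Primrec.option_some.comp hn)).not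

theorem PrimrecPred.list_subset {α : Type*} [Primcodable α] {σ τ : α → List ℕ}
    (hσ : Primrec σ) (hτ : Primrec τ) : PrimrecPred fun a => ∀ x ∈ σ a, x ∈ τ a := by
  have hmem : PrimrecRel fun (x : ℕ) (τ : List ℕ) => x ∈ τ :=
    ((PrimrecRel.exists_mem_list Primrec.eq).comp Primrec.snd Primrec.fst).of_eq
      fun p => by simp
  exact hmem.forall_mem_list.comp hσ hτ

theorem computable_stabilizingLearner (c : Code) : Computable (stabilizingLearner c) := by
  classical
  have hpair : Primrec (ofNat (List ℕ × ℕ)) := Primrec.ofNat _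
  have hlist : Primrec (ofNat (List ℕ)) := Primrec.ofNat _
  have hcand : PrimrecRel (Candidate c) := by
    refine (PrimrecPred.list_subset (Primrec.fst.comp (hpair.comp Primrec.snd)) Primrec.fst).and ?_
    have hr : PrimrecRel fun (r : ℕ) (p : List ℕ × ℕ) =>
        ¬ ((∀ x ∈ ofNat (List ℕ) r, x ∈ p.1) ∧ Changes c (ofNat (List ℕ × ℕ) p.2).1
          (ofNat (List ℕ × ℕ) p.2).2 (ofNat (List ℕ) r) p.1.length) := by
      have hτ : Primrec fun q : ℕ × List ℕ × ℕ => q.2.1 := Primrec.fst.comp Primrec.snd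
      have hk : Primrec fun q : ℕ × List ℕ × ℕ => ofNat (List ℕ × ℕ) q.2.2 :=
        hpair.comp (Primrec.snd.comp Primrec.snd)
      have hρ : Primrec fun q : ℕ × List ℕ × ℕ => ofNat (List ℕ) q.1 := hlist.comp Primrec.fst
      exact ((PrimrecPred.list_subset hρ hτ).and
        (PrimrecPred.changes (Primrec.const c) (Primrec.fst.comp hk) (Primrec.snd.comp hk) hρ
          (Primrec.list_length.comp hτ))).not
    exact (hr.forall_mem_list.comp (Primrec.list_range.comp (Primrec.list_length.comp Primrec.fst))
      Primrec.id).of_eq fun p => by simp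
  exact (Primrec.snd.comp (hpair.comp (Primrec.list_findIdx
    (Primrec.list_range.comp Primrec.list_length) hcand.decide))).to_comp

theorem exists_learnerOfCode_eq {M : List ℕ →. ℕ} (hM : Partrec M) :
    ∃ m, learnerOfCode m = M := by
  obtain ⟨c, hc⟩ := Code.exists_code.1 hM
  refine ⟨encode c, funext fun σ => ?_⟩
  rw [learnerOfCode, Denumerable.ofNat_encode, hc]
  simp [Part.map_id']

/-- Learnability of a u.c.e. family in terms of stabilizing pairs of a coded learner. -/
theorem mem_EXL_iff {e : ℕ} : e ∈ EXL ↔ ∃ m, ∀ i, (column e i).Nonempty →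
    (∃ σ n, (∀ x ∈ σ, x ∈ column e i) ∧ StableOn (learnerOfCode m) (column e i) σ n) ∧
    ∀ σ n, (∀ x ∈ σ, x ∈ column e i) → StableOn (learnerOfCode m) (column e i) σ n →
      Wset n = column e i := by
  constructor
  · rintro ⟨M, hM, hL⟩
    obtain ⟨m, rfl⟩ := exists_learnerOfCode_eq hM
    exact ⟨m, fun i hi => ⟨(hL i).exists_stableOn hi,
      fun σ n hσ hst => (hL i).Wset_eq_of_stableOn hi hσ hst⟩⟩
  · rintro ⟨m, h⟩
    refine ⟨_, (computable_stabilizingLearner (ofNat Code m)).partrec, fun i f hf => ?_⟩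
    obtain ⟨hex, hcor⟩ := h i (hf ▸ Set.range_nonempty f)
    rw [← hf] at hex hcor
    obtain ⟨σ, n, hσ, hst, hev⟩ := exists_eventually_stabilizingLearner_eq hex
    obtain ⟨N, hN⟩ := eventually_atTop.1 hev
    exact ⟨n, ⟨N, fun s hs => congrArg Part.some (hN s hs)⟩, hcor σ n hσ hst⟩

/-- `x` is enumerated into the `a`-th c.e. set within `t` steps. -/
def EnumeratedBy (a t x : ℕ) : Prop :=
  (ofNat Code a).evaln t x ≠ none

theorem EnumeratedBy.mono {a s t x : ℕ} (h : EnumeratedBy a s x) (hst : s ≤ t) :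
    EnumeratedBy a t x := by
  obtain ⟨v, hv⟩ := Option.ne_none_iff_exists'.1 h
  exact Option.ne_none_iff_exists'.2 ⟨v, Code.evaln_mono hst hv⟩

theorem mem_Wset_iff {a x : ℕ} : x ∈ Wset a ↔ ∃ t, EnumeratedBy a t x := by
  simp only [Wset, Set.mem_ofPred_eq, Part.dom_iff_mem, EnumeratedBy, Option.ne_none_iff_exists']
  constructor
  · rintro ⟨v, hv⟩
    obtain ⟨t, ht⟩ := Code.evaln_complete.1 hv
    exact ⟨t, v, ht⟩
  · rintro ⟨t, v, hv⟩
    exact ⟨v, Code.evaln_sound hv⟩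

theorem mem_column_iff {e i x : ℕ} : x ∈ column e i ↔ ∃ t, EnumeratedBy e t (Nat.pair i x) :=
  mem_Wset_iff

theorem forall_mem_column_iff {e i : ℕ} {l : List ℕ} : (∀ x ∈ l, x ∈ column e i) ↔
    ∃ t, ∀ x ∈ l, EnumeratedBy e t (Nat.pair i x) := by
  constructor
  · intro h
    induction l with
    | nil => exact ⟨0, by simp⟩
    | cons a l ih =>
      obtain ⟨s, hs⟩ := ih fun x hx => h x (by simp [hx])
      obtain ⟨t, ht⟩ := mem_column_iff.1 (h a (by simp))
      refine ⟨max s t, fun x hx => ?_⟩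
      rcases List.mem_cons.1 hx with rfl | hx
      · exact ht.mono (le_max_right _ _)
      · exact (hs x hx).mono (le_max_left _ _)
  · rintro ⟨t, ht⟩ x hx
    exact mem_column_iff.2 ⟨t, ht x hx⟩

/-- Within `t` steps, `ρ` is seen to be an extension of `σ` inside the `i`-th column of `W_e` on
which the `m`-th learner outputs a hypothesis other than `n`. -/
def Refutes (e m i : ℕ) (σ : List ℕ) (n : ℕ) (ρ : List ℕ) (t : ℕ) : Prop :=
  (∀ x ∈ ρ, EnumeratedBy e t (Nat.pair i x)) ∧ Changes (ofNat Code m) σ n ρ t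

theorem Refutes.mono {e m i n s t : ℕ} {σ ρ : List ℕ} (h : Refutes e m i σ n ρ s) (hst : s ≤ t) :
    Refutes e m i σ n ρ t :=
  ⟨fun x hx => (h.1 x hx).mono hst, h.2.mono hst⟩

theorem stableOn_column_iff {e m i n : ℕ} {σ : List ℕ} :
    StableOn (learnerOfCode m) (column e i) σ n ↔ ∀ ρ t, ¬ Refutes e m i σ n ρ t := by
  rw [stableOn_learnerOfCode_iff]
  constructor
  · rintro h ρ t ⟨h₁, h₂⟩
    exact h ρ (forall_mem_column_iff.2 ⟨t, h₁⟩) t h₂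
  · intro h ρ hρ t ht
    obtain ⟨s, hs⟩ := forall_mem_column_iff.1 hρ
    exact h ρ (max s t) ⟨fun x hx => (hs x hx).mono (le_max_left _ _), ht.mono (le_max_right _ _)⟩

theorem PrimrecPred.enumeratedBy {α : Type*} [Primcodable α] {a t x : α → ℕ}
    (ha : Primrec a) (ht : Primrec t) (hx : Primrec x) :
    PrimrecPred fun p => EnumeratedBy (a p) (t p) (x p) :=
  (Primrec.eq.comp (primrec_evaln_comp ht ((Primrec.ofNat Code).comp ha) hx)
    (Primrec.const none)).not

theorem PrimrecPred.forall_enumeratedBy {α : Type*} [Primcodable α] {e i t : α → ℕ}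
    {l : α → List ℕ} (he : Primrec e) (hi : Primrec i) (ht : Primrec t) (hl : Primrec l) :
    PrimrecPred fun p => ∀ x ∈ l p, EnumeratedBy (e p) (t p) (Nat.pair (i p) x) := by
  have h : PrimrecRel fun (x : ℕ) (p : α) => EnumeratedBy (e p) (t p) (Nat.pair (i p) x) :=
    PrimrecPred.enumeratedBy (he.comp Primrec.snd) (ht.comp Primrec.snd)
      (Primrec₂.natPair.comp (hi.comp Primrec.snd) Primrec.fst)
  exact h.forall_mem_list.comp hl Primrec.id

theorem PrimrecPred.refutes {α : Type*} [Primcodable α] {e m i n t : α → ℕ} {σ ρ : α → List ℕ}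
    (he : Primrec e) (hm : Primrec m) (hi : Primrec i) (hσ : Primrec σ) (hn : Primrec n)
    (hρ : Primrec ρ) (ht : Primrec t) :
    PrimrecPred fun p => Refutes (e p) (m p) (i p) (σ p) (n p) (ρ p) (t p) :=
  (PrimrecPred.forall_enumeratedBy he hi ht hρ).and
    (PrimrecPred.changes ((Primrec.ofNat Code).comp hm) hσ hn hρ ht)

theorem PrimrecPred.imp {α : Type*} [Primcodable α] {p q : α → Prop} (hp : PrimrecPred p)
    (hq : PrimrecPred q) : PrimrecPred fun a => p a → q a :=
  (hp.not.or hq).of_eq fun _ => imp_iff_not_or.symm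

theorem isSigma4_of_primrecPred {α β γ δ : Type} [Denumerable α] [Denumerable β] [Denumerable γ]
    [Denumerable δ] {P : Set ℕ} {R : ℕ × α × β × γ × δ → Prop} (hR : PrimrecPred R)
    (h : ∀ e, e ∈ P ↔ ∃ x, ∀ y, ∃ z, ∀ w, R (e, x, y, z, w)) : IsSigma4 P := by
  classical
  refine ⟨fun e x y z w => decide (R (e, ofNat α x, ofNat β y, ofNat γ z, ofNat δ w)), ?_, ?_⟩
  · refine (hR.decide.comp (Primrec.fst.pair (((Primrec.ofNat α).comp ?_).pair
      (((Primrec.ofNat β).comp ?_).pair (((Primrec.ofNat γ).comp ?_).pair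
      ((Primrec.ofNat δ).comp ?_)))))).to_comp
    · exact Primrec.fst.comp Primrec.snd
    · exact Primrec.fst.comp (Primrec.snd.comp Primrec.snd)
    · exact Primrec.fst.comp (Primrec.snd.comp (Primrec.snd.comp Primrec.snd))
    · exact Primrec.snd.comp (Primrec.snd.comp (Primrec.snd.comp Primrec.snd))
  · intro e
    have hs {ζ : Type} [Denumerable ζ] : Function.Surjective (ofNat ζ) :=
      fun a => ⟨encode a, Denumerable.ofNat_encode a⟩
    simp only [h, decide_eq_true_eq]
    exact hs.exists.trans <| exists_congr fun x => hs.forall.trans <| forall_congr' fun y =>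
      hs.exists.trans <| exists_congr fun z => hs.forall

/-- The matrix of the `∃∀∃∀` definition of `EXL`. With `x` witnessing nonemptiness of the `i`-th
column, `(σ', n')` is a stabilizing pair on it (`ρ'`, `t'` range over the possible refutations), and
the pair `(σ, n)` is either refuted or `W_n` and the column agree on `u`. -/
def EXLMatrix (e m i x t : ℕ) (σ : List ℕ) (n u : ℕ) (σ' : List ℕ) (n' s' : ℕ) (ρ : List ℕ) (s : ℕ)
    (ρ' : List ℕ) (t' : ℕ) : Prop :=
  EnumeratedBy e t (Nat.pair i x) →
    ((∀ y ∈ σ', EnumeratedBy e s' (Nat.pair i y)) ∧ ¬ Refutes e m i σ' n' ρ' t') ∧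
    ((∀ y ∈ σ, EnumeratedBy e t (Nat.pair i y)) → Refutes e m i σ n ρ s ∨
      ((EnumeratedBy n t u → EnumeratedBy e s (Nat.pair i u)) ∧
        (EnumeratedBy e t (Nat.pair i u) → EnumeratedBy n s u)))

theorem exists_forall_EXLMatrix_iff {e : ℕ} : e ∈ EXL ↔ ∃ m, ∀ i x t σ n u,
    ∃ σ' n' s' ρ s, ∀ ρ' t', EXLMatrix e m i x t σ n u σ' n' s' ρ s ρ' t' := by
  rw [mem_EXL_iff]
  refine exists_congr fun m => ⟨fun h i x t σ n u => ?_, fun h i ⟨x, hx⟩ => ?_⟩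
  · by_cases hx : EnumeratedBy e t (Nat.pair i x)
    · obtain ⟨⟨σ', n', hσ', hst'⟩, hcor⟩ := h i ⟨x, mem_column_iff.2 ⟨t, hx⟩⟩
      obtain ⟨s', hs'⟩ := forall_mem_column_iff.1 hσ'
      have hB : ∃ ρ s, (∀ y ∈ σ, EnumeratedBy e t (Nat.pair i y)) → Refutes e m i σ n ρ s ∨
          ((EnumeratedBy n t u → EnumeratedBy e s (Nat.pair i u)) ∧
            (EnumeratedBy e t (Nat.pair i u) → EnumeratedBy n s u)) := by
        by_cases hσ : ∀ y ∈ σ, EnumeratedBy e t (Nat.pair i y)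
        · by_cases hst : StableOn (learnerOfCode m) (column e i) σ n
          · have hW := hcor σ n (forall_mem_column_iff.2 ⟨t, hσ⟩) hst
            by_cases hu : u ∈ column e i
            · obtain ⟨s₁, hs₁⟩ := mem_column_iff.1 hu
              obtain ⟨s₂, hs₂⟩ := mem_Wset_iff.1 (hW ▸ hu)
              exact ⟨[], max s₁ s₂, fun _ => .inr ⟨fun _ => hs₁.mono (le_max_left _ _),
                fun _ => hs₂.mono (le_max_right _ _)⟩⟩
            · exact ⟨[], 0, fun _ => .inr ⟨fun hn => (hu (hW ▸ mem_Wset_iff.2 ⟨t, hn⟩)).elim,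
                fun hn => (hu (mem_column_iff.2 ⟨t, hn⟩)).elim⟩⟩
          · rw [stableOn_column_iff] at hst
            push Not at hst
            obtain ⟨ρ, s, hρ⟩ := hst
            exact ⟨ρ, s, fun _ => .inl hρ⟩
        · exact ⟨[], 0, fun hσ' => (hσ hσ').elim⟩
      obtain ⟨ρ, s, hB⟩ := hB
      exact ⟨σ', n', s', ρ, s, fun ρ' t' _ => ⟨⟨hs', stableOn_column_iff.1 hst' ρ' t'⟩, hB⟩⟩
    · exact ⟨[], 0, 0, [], 0, fun _ _ hx' => (hx hx').elim⟩
  · obtain ⟨t, ht⟩ := mem_column_iff.1 hx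
    refine ⟨?_, fun σ n hσ hst => ?_⟩
    · obtain ⟨σ', n', s', ρ, s, hA⟩ := h i x t [] 0 0
      exact ⟨σ', n', forall_mem_column_iff.2 ⟨s', (hA [] 0 ht).1.1⟩,
        stableOn_column_iff.2 fun ρ' t' => (hA ρ' t' ht).1.2⟩
    · obtain ⟨t₁, ht₁⟩ := forall_mem_column_iff.1 hσ
      have key : ∀ u t₂, ∃ s, (EnumeratedBy n t₂ u → EnumeratedBy e s (Nat.pair i u)) ∧
          (EnumeratedBy e t₂ (Nat.pair i u) → EnumeratedBy n s u) := by
        intro u t₂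
        have hle : t₁ ≤ max t (max t₁ t₂) := (le_max_left _ _).trans (le_max_right _ _)
        have hle₂ : t₂ ≤ max t (max t₁ t₂) := (le_max_right _ _).trans (le_max_right _ _)
        obtain ⟨σ', n', s', ρ, s, hB⟩ := h i x (max t (max t₁ t₂)) σ n u
        rcases (hB [] 0 (ht.mono (le_max_left _ _))).2 fun y hy => (ht₁ y hy).mono hle with hr | hr
        · exact (stableOn_column_iff.1 hst ρ s hr).elim
        · exact ⟨s, fun hn => hr.1 (hn.mono hle₂), fun hn => hr.2 (hn.mono hle₂)⟩
      ext u
      rw [mem_Wset_iff, mem_column_iff]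
      constructor
      · rintro ⟨t₂, ht₂⟩
        exact (key u t₂).imp fun s hs => hs.1 ht₂
      · rintro ⟨t₂, ht₂⟩
        exact (key u t₂).imp fun s hs => hs.2 ht₂

theorem PrimrecPred.EXLMatrix {α : Type*} [Primcodable α] {e m i x t n u n' s' s t' : α → ℕ}
    {σ σ' ρ ρ' : α → List ℕ} (he : Primrec e) (hm : Primrec m) (hi : Primrec i) (hx : Primrec x)
    (ht : Primrec t) (hσ : Primrec σ) (hn : Primrec n) (hu : Primrec u) (hσ' : Primrec σ')
    (hn' : Primrec n') (hs' : Primrec s') (hρ : Primrec ρ) (hs : Primrec s) (hρ' : Primrec ρ')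
    (ht' : Primrec t') :
    PrimrecPred fun a => EXLMatrix (e a) (m a) (i a) (x a) (t a) (σ a) (n a) (u a) (σ' a) (n' a)
      (s' a) (ρ a) (s a) (ρ' a) (t' a) := by
  have hiu := Primrec₂.natPair.comp hi hu
  exact (PrimrecPred.enumeratedBy he ht (Primrec₂.natPair.comp hi hx)).imp
    (((PrimrecPred.forall_enumeratedBy he hi hs' hσ').and
      (PrimrecPred.refutes he hm hi hσ' hn' hρ' ht').not).and
    ((PrimrecPred.forall_enumeratedBy he hi ht hσ).imp
      ((PrimrecPred.refutes he hm hi hσ hn hρ hs).or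
        (((PrimrecPred.enumeratedBy hn ht hu).imp (PrimrecPred.enumeratedBy he hs hiu)).and
          ((PrimrecPred.enumeratedBy he ht hiu).imp (PrimrecPred.enumeratedBy hn hs hu))))))

/-- EXL is a Σ⁰₄ set. -/
theorem EXL_isSigma4 : IsSigma4 EXL := by
  refine isSigma4_of_primrecPred (α := ℕ) (β := ℕ × ℕ × ℕ × List ℕ × ℕ × ℕ)
    (γ := List ℕ × ℕ × ℕ × List ℕ × ℕ) (δ := List ℕ × ℕ)
    (R := fun p => EXLMatrix p.1 p.2.1 p.2.2.1.1 p.2.2.1.2.1 p.2.2.1.2.2.1 p.2.2.1.2.2.2.1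
      p.2.2.1.2.2.2.2.1 p.2.2.1.2.2.2.2.2 p.2.2.2.1.1 p.2.2.2.1.2.1 p.2.2.2.1.2.2.1
      p.2.2.2.1.2.2.2.1 p.2.2.2.1.2.2.2.2 p.2.2.2.2.1 p.2.2.2.2.2) ?_ fun e => ?_
  · have h {α β γ δ ε : Type} [Primcodable α] [Primcodable β] [Primcodable γ] [Primcodable δ]
        [Primcodable ε] : Primrec (fun p : α × β × γ × δ × ε => p.2.2.1) ∧
          Primrec (fun p : α × β × γ × δ × ε => p.2.2.2.1) ∧
          Primrec (fun p : α × β × γ × δ × ε => p.2.2.2.2) :=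
      ⟨Primrec.fst.comp (Primrec.snd.comp Primrec.snd),
        Primrec.fst.comp (Primrec.snd.comp (Primrec.snd.comp Primrec.snd)),
        Primrec.snd.comp (Primrec.snd.comp (Primrec.snd.comp Primrec.snd))⟩
    obtain ⟨hy, hz, hw⟩ := @h ℕ ℕ (ℕ × ℕ × ℕ × List ℕ × ℕ × ℕ) (List ℕ × ℕ × ℕ × List ℕ × ℕ)
      (List ℕ × ℕ) _ _ _ _ _
    have hy' := Primrec.snd.comp (Primrec.snd.comp hy)
    have hz' := Primrec.snd.comp (Primrec.snd.comp hz)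
    exact PrimrecPred.EXLMatrix Primrec.fst (Primrec.fst.comp Primrec.snd) (Primrec.fst.comp hy)
      (Primrec.fst.comp (Primrec.snd.comp hy)) (Primrec.fst.comp hy')
      (Primrec.fst.comp (Primrec.snd.comp hy'))
      (Primrec.fst.comp (Primrec.snd.comp (Primrec.snd.comp hy')))
      (Primrec.snd.comp (Primrec.snd.comp (Primrec.snd.comp hy'))) (Primrec.fst.comp hz)
      (Primrec.fst.comp (Primrec.snd.comp hz)) (Primrec.fst.comp hz')
      (Primrec.fst.comp (Primrec.snd.comp hz')) (Primrec.snd.comp (Primrec.snd.comp hz'))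
      (Primrec.fst.comp hw) (Primrec.snd.comp hw)
  · simp only [exists_forall_EXLMatrix_iff, Prod.forall, Prod.exists]
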